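/- Let M be a Lie module over 𝔤, let λ ∈ 𝔱*, and let v ∈ M satisfy H·v = λ(H)·v for all H ∈ 𝔱 and E_{−α}·v = 0 for all α ∈ Φ⁺ (i.e. v is a lowest weight vector of weight λ). Then ∑_{i=1}^r H_i·(H_i·v) + ∑_{α∈Φ⁺} ( E_α·(E_{−α}·v) + E_{−α}·(E_α·v) ) = (⟨λ,λ⟩ − 2⟨δ,λ⟩)·v; that is, the Casimir operator acts on v by the scalar |λ|² − 2⟨δ,λ⟩. -/

import Mathlib

open scoped BigOperators

/-- **The Casimir element acts on a lowest weight vector by `|λ|² − 2⟨δ,λ⟩`.**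

Let `L` be a finite-dimensional complex semisimple Lie algebra with Killing form `B`,
and let `𝔱 ⊆ L` be a Cartan subalgebra.  Let `H₁, …, H_r` be a basis of `𝔱` which is
orthonormal for `B`.  Let `(root a)_{a : ι}` be the (pairwise distinct, nonzero) positive
roots, and for each positive root choose root vectors `Eα a ∈ 𝔤_{root a}` and
`Eneg a ∈ 𝔤_{−root a}` normalized so that `B (Eα a) (Eneg a) = 1`; then
`⁅Eα a, Eneg a⁆ = H_{root a}`, where for a linear functional `λ` on `𝔱` the element
`H_λ ∈ 𝔱` is characterized by `B H H_λ = λ H` for all `H ∈ 𝔱` (so that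
`⟨λ, μ⟩ = B H_λ H_μ = λ H_μ = μ H_λ`).

If `M` is a Lie module over `L`, `lam` a linear functional on `𝔱` and `v ∈ M` is a
lowest weight vector of weight `lam` (i.e. `H·v = lam(H)·v` for `H ∈ 𝔱` and
`E₋α·v = 0` for all positive roots `α`), then
`∑ᵢ Hᵢ·(Hᵢ·v) + ∑_{α∈Φ⁺} (E_α·(E₋α·v) + E₋α·(E_α·v)) = (⟨λ,λ⟩ − 2⟨δ,λ⟩)·v`,
where `⟨λ,λ⟩ = lam H_lam` and `2⟨δ,λ⟩ = ∑_{α∈Φ⁺} α(H_lam)`. -/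
theorem casimir_acts_on_lowest_weight_vector
    {L : Type*} [LieRing L] [LieAlgebra ℂ L] [Module.Finite ℂ L]
    [LieAlgebra.IsSemisimple ℂ L]
    (𝔱 : LieSubalgebra ℂ L) [𝔱.IsCartanSubalgebra]
    {M : Type*} [AddCommGroup M] [Module ℂ M] [LieRingModule L M] [LieModule ℂ L M]
    -- an orthonormal basis of the Cartan subalgebra with respect to the Killing form
    (r : ℕ) (Hbasis : Module.Basis (Fin r) ℂ 𝔱)
    (horth : ∀ i j, killingForm ℂ L (Hbasis i : L) (Hbasis j : L) = if i = j then 1 else 0)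
    -- the positive roots, indexed by a finite type
    {ι : Type*} [Fintype ι] (root : ι → (𝔱 →ₗ[ℂ] ℂ))
    (hroot_inj : Function.Injective root) (hroot_ne : ∀ a, root a ≠ 0)
    -- root vectors `E_α ∈ 𝔤_α` and `E_{−α} ∈ 𝔤_{−α}` for each positive root `α`
    (Eα Eneg : ι → L)
    (hEα : ∀ a, ∀ H : 𝔱, ⁅(H : L), Eα a⁆ = root a H • Eα a)
    (hEneg : ∀ a, ∀ H : 𝔱, ⁅(H : L), Eneg a⁆ = -root a H • Eneg a)
    -- normalized so that `B(E_α, E_{−α}) = 1`, whence `⁅E_α, E_{−α}⁆ = H_α`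
    (hnorm : ∀ a, killingForm ℂ L (Eα a) (Eneg a) = 1)
    (Hroot : ι → 𝔱) (hHroot : ∀ a, ∀ H : 𝔱, killingForm ℂ L (H : L) (Hroot a : L) = root a H)
    (hbracket : ∀ a, ⁅Eα a, Eneg a⁆ = (Hroot a : L))
    -- the weight `λ` and its dual element `H_λ ∈ 𝔱`
    (lam : 𝔱 →ₗ[ℂ] ℂ) (Hlam : 𝔱)
    (hHlam : ∀ H : 𝔱, killingForm ℂ L (H : L) (Hlam : L) = lam H)
    -- a lowest weight vector `v` of weight `λ`
    (v : M)
    (hv_wt : ∀ H : 𝔱, ⁅(H : L), v⁆ = lam H • v)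
    (hv_low : ∀ a, ⁅Eneg a, v⁆ = 0) :
    (∑ i, ⁅(Hbasis i : L), ⁅(Hbasis i : L), v⁆⁆)
        + ∑ a, (⁅Eα a, ⁅Eneg a, v⁆⁆ + ⁅Eneg a, ⁅Eα a, v⁆⁆)
      = (lam Hlam - ∑ a, root a Hlam) • v := by
  have hrepr : ∀ i, Hbasis.repr Hlam i = lam (Hbasis i) := by
    intro i
    have hcoord : killingForm ℂ L (Hbasis i : L) ∘ₗ 𝔱.toSubmodule.subtype = Hbasis.coord i :=
      Hbasis.ext fun j => (horth i j).trans <| by simp [Finsupp.single_apply, eq_comm]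
    rw [← hHlam]
    exact (LinearMap.congr_fun hcoord Hlam).symm
  have hlam : lam Hlam = ∑ i, lam (Hbasis i) * lam (Hbasis i) := by
    conv_lhs => rw [← Hbasis.sum_repr Hlam]
    simp [hrepr]
  have hCartan : ∀ i, ⁅(Hbasis i : L), ⁅(Hbasis i : L), v⁆⁆
      = (lam (Hbasis i) * lam (Hbasis i)) • v := by
    intro i
    rw [hv_wt, lie_smul, hv_wt, smul_smul]
  have hpair : ∀ a, lam (Hroot a) = root a Hlam := by
    intro a
    rw [← hHlam, ← hHroot, LieModule.traceForm_comm]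
  have hRoot : ∀ a, ⁅Eα a, ⁅Eneg a, v⁆⁆ + ⁅Eneg a, ⁅Eα a, v⁆⁆ = -(root a Hlam • v) := by
    intro a
    have hlie := lie_lie (Eα a) (Eneg a) v
    rw [hbracket, hv_wt, hpair, hv_low, lie_zero, zero_sub] at hlie
    rw [hv_low, lie_zero, zero_add, hlie, neg_neg]
  simp only [hCartan, hRoot, hlam, Finset.sum_neg_distrib, ← Finset.sum_smul, add_smul,
    neg_smul, sub_eq_add_neg]
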